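/- If P is a compact property for holomorphic maps into the Riemann sphere, then every element of 𝒫(ℂ) is a constant map; that is, any meromorphic function on the complex plane ℂ satisfying a compact property P is constant. -/

import Mathlib

open Filter Set MeasureTheory Topology
open scoped ENNReal

noncomputable section

/-- Half of the chordal (spherical) distance on the Riemann sphere `OnePoint ℂ`. -/
def sphDist : OnePoint ℂ → OnePoint ℂ → ℝ
  | OnePoint.infty, OnePoint.infty => 0
  | OnePoint.infty, (w : ℂ) => 1 / Real.sqrt (1 + ‖w‖ ^ 2)
  | (z : ℂ), OnePoint.infty => 1 / Real.sqrt (1 + ‖z‖ ^ 2)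
  | (z : ℂ), (w : ℂ) => ‖z - w‖ / (Real.sqrt (1 + ‖z‖ ^ 2) * Real.sqrt (1 + ‖w‖ ^ 2))

/-- A map `f : ℂ → Ĉ` is holomorphic on `U` if near each point of `U` it is, in the chart,
either a coerced holomorphic function or the reciprocal of a holomorphic function. -/
def SphHolomorphicOn (f : ℂ → OnePoint ℂ) (U : Set ℂ) : Prop :=
  ∀ z ∈ U, ∃ V : Set ℂ, IsOpen V ∧ z ∈ V ∧ ∃ h : ℂ → ℂ, DifferentiableOn ℂ h V ∧
    ((∀ w ∈ V, f w = (h w : OnePoint ℂ)) ∨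
     (∀ w ∈ V, f w = if h w = 0 then OnePoint.infty else (((h w)⁻¹ : ℂ) : OnePoint ℂ)))

/-- Locally uniform convergence on `U` with respect to the spherical distance. -/
def SphLocUnifOn (F : ℕ → ℂ → OnePoint ℂ) (f : ℂ → OnePoint ℂ) (U : Set ℂ) : Prop :=
  ∀ K : Set ℂ, K ⊆ U → IsCompact K → ∀ ε > (0:ℝ),
    ∀ᶠ n in Filter.atTop, ∀ z ∈ K, sphDist (F n z) (f z) < ε

/-- Locally uniform convergence of real-valued functions on `U`. -/
def RealLocUnifOn (F : ℕ → ℂ → ℝ) (f : ℂ → ℝ) (U : Set ℂ) : Prop :=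
  ∀ K : Set ℂ, K ⊆ U → IsCompact K → ∀ ε > (0:ℝ),
    ∀ᶠ n in Filter.atTop, ∀ z ∈ K, |F n z - f z| < ε

/-- A closed property for holomorphic maps into the Riemann sphere (on plane domains). -/
structure IsClosedProperty (P : Set ℂ → (ℂ → OnePoint ℂ) → Prop) : Prop where
  mem_holo : ∀ (U : Set ℂ) (f : ℂ → OnePoint ℂ), IsOpen U → IsConnected U →
    P U f → SphHolomorphicOn f U
  /-- (P1): stability under precomposition with unramified holomorphic maps. -/
  comp : ∀ (U V : Set ℂ) (φ : ℂ → ℂ) (f : ℂ → OnePoint ℂ),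
    IsOpen U → IsConnected U → IsOpen V → IsConnected V →
    DifferentiableOn ℂ φ U → Set.MapsTo φ U V → (∀ z ∈ U, deriv φ z ≠ 0) →
    P V f → P U (f ∘ φ)
  /-- (P2): if `f` has the property on every relatively compact subdomain, it has it globally. -/
  exhaust : ∀ (U : Set ℂ) (f : ℂ → OnePoint ℂ), IsOpen U → IsConnected U →
    SphHolomorphicOn f U →
    (∀ Ω : Set ℂ, IsOpen Ω → IsConnected Ω → IsCompact (closure Ω) → closure Ω ⊆ U → P Ω f) →
    P U f
  /-- (P3): `𝒫(U)` is closed under locally uniform spherical convergence in `𝑀(U)`. -/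
  closed : ∀ (U : Set ℂ) (f : ℂ → OnePoint ℂ) (F : ℕ → ℂ → OnePoint ℂ),
    IsOpen U → IsConnected U → (∀ n, P U (F n)) → SphLocUnifOn F f U →
    SphHolomorphicOn f U → P U f

/-- A compact property: a closed property all of whose families `𝒫(U)` are normal. -/
structure IsCompactProperty (P : Set ℂ → (ℂ → OnePoint ℂ) → Prop) extends
    IsClosedProperty P : Prop where
  /-- (P4): normality of `𝒫(U)` for every domain `U`. -/
  normal : ∀ (U : Set ℂ), IsOpen U → IsConnected U →
    ∀ F : ℕ → ℂ → OnePoint ℂ, (∀ n, P U (F n)) →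
      ∃ φ : ℕ → ℕ, StrictMono φ ∧ ∃ g : ℂ → OnePoint ℂ, SphLocUnifOn (F ∘ φ) g U

/-- The spherical derivative of a map into the Riemann sphere (limit of spherical
difference quotients). For `f` meromorphic near `z` this equals `|f'|/(1+|f|²)`. -/
def sphD (f : ℂ → OnePoint ℂ) (z : ℂ) : ℝ :=
  limUnder (𝓝[≠] z) (fun w => sphDist (f w) (f z) / ‖w - z‖)

/-- A Weierstrass `m`-triple on a plane domain `U`: a holomorphic `1`-form `f dz`, a
meromorphic function `g`, and the (continuous positive) conformal density `lam` of the
metric `ds² = (1+|g|²)^m |f|² |dz|²`. -/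
structure WeierstrassTriple (m : ℕ) (U : Set ℂ) where
  isOpen : IsOpen U
  isConnected : IsConnected U
  f : ℂ → ℂ
  g : ℂ → OnePoint ℂ
  f_holo : DifferentiableOn ℂ f U
  g_holo : SphHolomorphicOn g U
  g_mero : ∃ z ∈ U, g z ≠ OnePoint.infty
  lam : ℂ → ℝ
  lam_cont : ContinuousOn lam U
  lam_pos : ∀ z ∈ U, 0 < lam z
  lam_eq : ∀ z ∈ U, ∀ w : ℂ, g z = (w : OnePoint ℂ) →
    lam z = (1 + ‖w‖ ^ 2) ^ ((m : ℝ) / 2) * ‖f z‖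

/-- The Gaussian curvature `K = -2m |g'|²/((1+|g|²)^{m+2}|f|²)` of a Weierstrass
`m`-triple, written via the spherical derivative: `K = -2m (g^#)² / λ²`. -/
def WeierstrassTriple.curv {m : ℕ} {U : Set ℂ} (T : WeierstrassTriple m U) (z : ℂ) : ℝ :=
  -(2 * m) * (sphD T.g z) ^ 2 / (T.lam z) ^ 2

/-- A divergent `C¹` path in `U` starting at `p`, parametrized by `[0,1)`. -/
structure DivergentPath (U : Set ℂ) (p : ℂ) where
  toFun : ℝ → ℂ
  start : toFun 0 = p
  mem : ∀ t ∈ Set.Ico (0:ℝ) 1, toFun t ∈ U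
  cont : ContinuousOn toFun (Set.Ico (0:ℝ) 1)
  diff : ∀ t ∈ Set.Ioo (0:ℝ) 1, DifferentiableAt ℝ toFun t
  divergent : ∀ K : Set ℂ, IsCompact K → K ⊆ U →
    ∃ t₀ ∈ Set.Ico (0:ℝ) 1, ∀ t, t₀ ≤ t → t < 1 → toFun t ∉ K

/-- The length of a path with respect to the conformal metric with density `lam`. -/
def pathLen (lam : ℂ → ℝ) (γ : ℝ → ℂ) : ℝ≥0∞ :=
  ∫⁻ t in Set.Ioo (0:ℝ) 1, ENNReal.ofReal (lam (γ t) * ‖deriv γ t‖)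

/-- The geodesic distance from `p` to the boundary of `U`: the infimum of lengths of
divergent paths starting at `p`. -/
def distToBdry (lam : ℂ → ℝ) (U : Set ℂ) (p : ℂ) : ℝ≥0∞ :=
  ⨅ γ : DivergentPath U p, pathLen lam γ.toFun

/-- Completeness of the conformal metric with density `lam` on `U`: every divergent path
has infinite length. -/
def IsCompleteMetric (lam : ℂ → ℝ) (U : Set ℂ) : Prop :=
  ∀ p ∈ U, ∀ γ : DivergentPath U p, pathLen lam γ.toFun = ⊤

/-- The property `P_L`: `|f| < L` on `U`, or `f` is constant on `U`. -/
def PL (L : ℝ) (U : Set ℂ) (f : ℂ → OnePoint ℂ) : Prop :=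
  SphHolomorphicOn f U ∧
    ((∀ z ∈ U, ∃ w : ℂ, f z = (w : OnePoint ℂ) ∧ ‖w‖ < L) ∨
      (∀ z ∈ U, ∀ w ∈ U, f z = f w))

/-- The property `P_X`: `f` omits every value of `X`, or `f` is constant on `U`. -/
def PX (X : Set (OnePoint ℂ)) (U : Set ℂ) (f : ℂ → OnePoint ℂ) : Prop :=
  SphHolomorphicOn f U ∧ ((∀ z ∈ U, f z ∉ X) ∨ (∀ z ∈ U, ∀ w ∈ U, f z = f w))

/-- Second directional derivative of `u : ℂ → ℝ` at `z` in direction `v`. -/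
def dirDeriv2 (u : ℂ → ℝ) (z v : ℂ) : ℝ :=
  deriv (deriv (fun t : ℝ => u (z + t • v))) 0

/-- The Euclidean Laplacian of `u : ℂ → ℝ`. -/
def laplacian (u : ℂ → ℝ) (z : ℂ) : ℝ :=
  dirDeriv2 u z 1 + dirDeriv2 u z Complex.I


/-- A compact property `P` satisfies the `m`-curvature estimate if there is `C > 0` such
that `|K| d² ≤ C` for every Weierstrass `m`-triple whose meromorphic function satisfies `P`. -/
def SatisfiesCurvatureEstimate (P : Set ℂ → (ℂ → OnePoint ℂ) → Prop) (m : ℕ) : Prop :=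
  ∃ C : ℝ, 0 < C ∧ ∀ (U : Set ℂ) (T : WeierstrassTriple m U), P U T.g →
    ∀ p ∈ U, ENNReal.ofReal |T.curv p| * (distToBdry T.lam U p) ^ 2 ≤ ENNReal.ofReal C

/-- Inverse stereographic projection onto the sphere of diameter `1` tangent at the origin
(the image of `∞`) to a plane parallel to `ℂ`. -/
def sphEmbed : OnePoint ℂ → WithLp 2 (ℂ × ℝ)
  | OnePoint.infty => 0
  | (z : ℂ) => (1 / ‖WithLp.toLp 2 (z, (1 : ℝ))‖) ^ 2 • WithLp.toLp 2 (z, (1 : ℝ))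

lemma norm_toLp_one (z : ℂ) : ‖WithLp.toLp 2 (z, (1 : ℝ))‖ = √(1 + ‖z‖ ^ 2) := by
  rw [WithLp.prod_norm_eq_of_L2]
  simp [add_comm]

lemma sqrt_one_add_norm_sq_pos (z : ℂ) : 0 < √(1 + ‖z‖ ^ 2) := by positivity

lemma norm_sphEmbed_coe (z : ℂ) : ‖sphEmbed (z : OnePoint ℂ)‖ = 1 / √(1 + ‖z‖ ^ 2) := by
  have h := sqrt_one_add_norm_sq_pos z
  change ‖(1 / ‖WithLp.toLp 2 (z, (1 : ℝ))‖) ^ 2 • WithLp.toLp 2 (z, (1 : ℝ))‖ = _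
  rw [norm_smul, norm_toLp_one, Real.norm_of_nonneg (by positivity)]
  field_simp

lemma sphDist_eq_dist (p q : OnePoint ℂ) : sphDist p q = dist (sphEmbed p) (sphEmbed q) := by
  induction p using OnePoint.rec with
  | infty =>
    induction q using OnePoint.rec with
    | infty => exact (dist_self _).symm
    | coe w =>
      change 1 / √(1 + ‖w‖ ^ 2) = dist 0 _
      rw [dist_zero_left, norm_sphEmbed_coe]
  | coe z =>
    induction q using OnePoint.rec with
    | infty =>
      change 1 / √(1 + ‖z‖ ^ 2) = dist _ 0
      rw [dist_zero_right, norm_sphEmbed_coe]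
    | coe w =>
      have hne : ∀ u : ℂ, WithLp.toLp 2 (u, (1 : ℝ)) ≠ 0 := fun u => by
        rw [← norm_pos_iff, norm_toLp_one]
        exact sqrt_one_add_norm_sq_pos u
      have hd : dist (WithLp.toLp 2 (z, (1 : ℝ))) (WithLp.toLp 2 (w, (1 : ℝ))) = ‖z - w‖ := by
        rw [WithLp.prod_dist_eq_of_L2]
        simp [dist_eq_norm]
      change ‖z - w‖ / (√(1 + ‖z‖ ^ 2) * √(1 + ‖w‖ ^ 2)) =
        dist ((1 / ‖WithLp.toLp 2 (z, (1 : ℝ))‖) ^ 2 • WithLp.toLp 2 (z, (1 : ℝ)))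
          ((1 / ‖WithLp.toLp 2 (w, (1 : ℝ))‖) ^ 2 • WithLp.toLp 2 (w, (1 : ℝ)))
      rw [dist_div_norm_sq_smul (hne z) (hne w), hd, norm_toLp_one, norm_toLp_one]
      ring

lemma sphDist_comm (p q : OnePoint ℂ) : sphDist p q = sphDist q p := by
  simp only [sphDist_eq_dist, dist_comm]

lemma sphDist_triangle (p q r : OnePoint ℂ) : sphDist p r ≤ sphDist p q + sphDist q r := by
  simpa only [sphDist_eq_dist] using dist_triangle _ _ _

lemma eq_of_sphDist_nonpos {p q : OnePoint ℂ} (h : sphDist p q ≤ 0) : p = q := by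
  induction p using OnePoint.rec with
  | infty =>
    induction q using OnePoint.rec with
    | infty => rfl
    | coe w => exact absurd h (not_le.2 (one_div_pos.2 (sqrt_one_add_norm_sq_pos w)))
  | coe z =>
    induction q using OnePoint.rec with
    | infty => exact absurd h (not_le.2 (one_div_pos.2 (sqrt_one_add_norm_sq_pos z)))
    | coe w =>
      by_contra hne
      have hzw : z ≠ w := fun h => hne (congrArg _ h)
      have hpos : 0 < ‖z - w‖ / (√(1 + ‖z‖ ^ 2) * √(1 + ‖w‖ ^ 2)) :=
        div_pos (norm_pos_iff.2 (sub_ne_zero.2 hzw))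
          (mul_pos (sqrt_one_add_norm_sq_pos z) (sqrt_one_add_norm_sq_pos w))
      exact absurd h (not_le.2 hpos)

lemma sphDist_coe_le (z w : ℂ) : sphDist (z : OnePoint ℂ) (w : OnePoint ℂ) ≤ ‖z - w‖ := by
  change ‖z - w‖ / (√(1 + ‖z‖ ^ 2) * √(1 + ‖w‖ ^ 2)) ≤ _
  refine div_le_self (norm_nonneg _) (one_le_mul_of_one_le_of_one_le ?_ ?_) <;>
  · rw [Real.one_le_sqrt]
    nlinarith [sq_nonneg ‖z‖, sq_nonneg ‖w‖]

lemma sqrt_one_add_norm_inv_sq {z : ℂ} (hz : z ≠ 0) :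
    √(1 + ‖z⁻¹‖ ^ 2) = √(1 + ‖z‖ ^ 2) / ‖z‖ := by
  have h : 0 < ‖z‖ := norm_pos_iff.2 hz
  rw [norm_inv, Real.sqrt_eq_iff_mul_self_eq (by positivity) (by positivity), div_mul_div_comm,
    Real.mul_self_sqrt (by positivity)]
  field_simp
  ring

/-- Inversion `z ↦ 1 / z` of the Riemann sphere, restricted to finite arguments. -/
def sphInv (z : ℂ) : OnePoint ℂ :=
  if z = 0 then OnePoint.infty else ((z⁻¹ : ℂ) : OnePoint ℂ)

lemma sphDist_infty_inv {w : ℂ} (hw : w ≠ 0) :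
    sphDist OnePoint.infty ((w⁻¹ : ℂ) : OnePoint ℂ) ≤ ‖w‖ := by
  change 1 / √(1 + ‖w⁻¹‖ ^ 2) ≤ ‖w‖
  rw [sqrt_one_add_norm_inv_sq hw, one_div_div]
  refine div_le_self (norm_nonneg _) ?_
  rw [Real.one_le_sqrt]
  nlinarith [sq_nonneg ‖w‖]

lemma sphDist_sphInv_le (z w : ℂ) : sphDist (sphInv z) (sphInv w) ≤ ‖z - w‖ := by
  unfold sphInv
  split_ifs with hz hw hw
  · exact norm_nonneg _
  · simpa [hz] using sphDist_infty_inv hw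
  · rw [sphDist_comm]
    simpa [hw] using sphDist_infty_inv hz
  · refine le_trans (le_of_eq ?_) (sphDist_coe_le z w)
    change ‖z⁻¹ - w⁻¹‖ / (√(1 + ‖z⁻¹‖ ^ 2) * √(1 + ‖w⁻¹‖ ^ 2)) =
      ‖z - w‖ / (√(1 + ‖z‖ ^ 2) * √(1 + ‖w‖ ^ 2))
    have h1 := norm_pos_iff.2 hz
    have h2 := norm_pos_iff.2 hw
    have h3 := sqrt_one_add_norm_sq_pos z
    have h4 := sqrt_one_add_norm_sq_pos w
    rw [sqrt_one_add_norm_inv_sq hz, sqrt_one_add_norm_inv_sq hw, inv_sub_inv hz hw, norm_div,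
      norm_mul, norm_sub_rev w z]
    field_simp

/-- A holomorphic map into the Riemann sphere is continuous for the spherical distance. -/
lemma SphHolomorphicOn.eventually_sphDist_lt {f : ℂ → OnePoint ℂ} {U : Set ℂ}
    (hf : SphHolomorphicOn f U) {a : ℂ} (ha : a ∈ U) {ε : ℝ} (hε : 0 < ε) :
    ∀ᶠ z in 𝓝 a, sphDist (f z) (f a) < ε := by
  obtain ⟨V, hV, haV, h, hh, hfh⟩ := hf a ha
  have hVa : V ∈ 𝓝 a := hV.mem_nhds haV
  have hcont : ∀ᶠ z in 𝓝 a, ‖h z - h a‖ < ε := by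
    simpa only [dist_eq_norm] using
      Metric.tendsto_nhds.1 (hh.differentiableAt hVa).continuousAt ε hε
  filter_upwards [hVa, hcont] with z hzV hz
  refine lt_of_le_of_lt ?_ hz
  rcases hfh with hfh | hfh
  · rw [hfh z hzV, hfh a haV]
    exact sphDist_coe_le _ _
  · rw [hfh z hzV, hfh a haV]
    exact sphDist_sphInv_le _ _

/-- Any meromorphic function on `ℂ` satisfying a compact property `P` is constant. -/
theorem compact_property_constant_on_plane
    (P : Set ℂ → (ℂ → OnePoint ℂ) → Prop) (hP : IsCompactProperty P)
    (f : ℂ → OnePoint ℂ) (hf : P Set.univ f) :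
    ∀ z w : ℂ, f z = f w := by
  have hholo := hP.mem_holo _ _ isOpen_univ isConnected_univ hf
  have hscale : ∀ n : ℕ, P univ (f ∘ fun z => ((n : ℂ) + 1) * z) := fun n => by
    refine hP.comp univ univ _ f isOpen_univ isConnected_univ isOpen_univ isConnected_univ
      (by fun_prop) (mapsTo_univ _ _) (fun z _ => ?_) hf
    rw [deriv_const_mul_id']
    exact Nat.cast_add_one_ne_zero n
  obtain ⟨φ, hφ, g, hg⟩ := hP.normal univ isOpen_univ isConnected_univ _ hscale
  suffices h0 : ∀ w, f w = f 0 from fun z w => (h0 z).trans (h0 w).symm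
  intro w
  refine eq_of_sphDist_nonpos (le_of_forall_pos_le_add fun ε hε => ?_)
  have hg' := hg (Metric.closedBall 0 1) (subset_univ _) (isCompact_closedBall 0 1) (ε / 3)
    (by positivity)
  obtain ⟨N, hN⟩ := hg'.exists
  have hcont : ∀ᶠ z : ℂ in 𝓝 0, sphDist (f (((φ N : ℕ) + 1 : ℂ) * z)) (f 0) < ε / 3 := by
    have ht : Tendsto (fun z : ℂ => ((φ N : ℂ) + 1) * z) (𝓝 0) (𝓝 0) :=
      Continuous.tendsto' (by fun_prop) _ _ (mul_zero _)
    exact ht.eventually (hholo.eventually_sphDist_lt (mem_univ 0) (by positivity))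
  have hlim : Tendsto (fun n : ℕ => w / ((φ n : ℂ) + 1)) atTop (𝓝 0) := by
    have h1 : Tendsto (fun n : ℕ => w * (1 / ((n : ℂ) + 1))) atTop (𝓝 0) := by
      simpa using (tendsto_one_div_add_atTop_nhds_zero_nat (𝕜 := ℂ)).const_mul w
    simpa [Function.comp_def, div_eq_mul_inv] using h1.comp hφ.tendsto_atTop
  obtain ⟨n, hn, hnc, hnb⟩ := (hg'.and ((hlim.eventually hcont).and
    (hlim.eventually (Metric.closedBall_mem_nhds 0 one_pos)))).exists
  have h1 := hn _ hnb
  have h2 := hN _ hnb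
  simp only [Function.comp_apply] at h1 h2
  rw [mul_div_cancel₀ _ (Nat.cast_add_one_ne_zero (φ n))] at h1
  rw [sphDist_comm] at h2
  have h3 := sphDist_triangle (f w) (g (w / ((φ n : ℂ) + 1))) (f 0)
  have h4 := sphDist_triangle (g (w / ((φ n : ℂ) + 1)))
    (f (((φ N : ℂ) + 1) * (w / ((φ n : ℂ) + 1)))) (f 0)
  linarith

end
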